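/- There exist a real-analytic curve γ : ℝ → ℝ³ with γ(t+2π) = γ(t) and γ'(t) ≠ 0 for all t, a real-analytic vector field ξ : ℝ → ℝ³ with ξ(t+2π) = −ξ(t), γ'(t) × ξ(t) ≠ 0, det(γ'(t), ξ(t), ξ'(t)) = 0 and ξ'(t)·γ''(t) = 0 for all t, and a real ε > 0 such that for all t,s ∈ ℝ and u,v ∈ (−ε,ε), if γ(t) + u·ξ(t) = γ(s) + v·ξ(s) then there is an integer k with s = t + 2πk and v = (−1)^k·u. (Existence of an embedded real-analytic rectifying Möbius developable: the strip F(t,u) = γ(t) + u·ξ(t) is flat, its centerline γ is a geodesic on it, the anti-periodicity of ξ makes it a Möbius strip, and the last condition makes it embedded.) -/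

import Mathlib

open Real

noncomputable abbrev E3 := EuclideanSpace ℝ (Fin 3)

/-- The cross product of vectors in Euclidean 3-space. -/
noncomputable def cross3 (u v : E3) : E3 :=
  (WithLp.equiv 2 (Fin 3 → ℝ)).symm
    ![u 1 * v 2 - u 2 * v 1, u 2 * v 0 - u 0 * v 2, u 0 * v 1 - u 1 * v 0]

/-- The dot product of vectors in Euclidean 3-space. -/
noncomputable def dot3 (u v : E3) : ℝ := u 0 * v 0 + u 1 * v 1 + u 2 * v 2

/-- The determinant of the 3×3 matrix with columns `u`, `v`, `w`. -/
noncomputable def det3 (u v w : E3) : ℝ := dot3 u (cross3 v w)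

open scoped ContDiff

/-! ### Vectors of `E3` given by coordinates -/

theorem hasDerivAt_vec3 {x y z : ℝ → ℝ} {x' y' z' t : ℝ} (hx : HasDerivAt x x' t)
    (hy : HasDerivAt y y' t) (hz : HasDerivAt z z' t) :
    HasDerivAt (fun s => (!₂[x s, y s, z s] : E3)) !₂[x', y', z'] t := by
  have h : HasDerivAt (fun s => ![x s, y s, z s]) ![x', y', z'] t := by
    rw [hasDerivAt_pi]
    intro i
    fin_cases i <;> simpa
  exact ((PiLp.continuousLinearEquiv 2 ℝ (fun _ : Fin 3 => ℝ)).symm.toContinuousLinearMap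
    |>.hasFDerivAt.comp_hasDerivAt t h)

theorem contDiff_vec3 {n : WithTop ℕ∞} {x y z : ℝ → ℝ} (hx : ContDiff ℝ n x)
    (hy : ContDiff ℝ n y) (hz : ContDiff ℝ n z) :
    ContDiff ℝ n (fun s => (!₂[x s, y s, z s] : E3)) := by
  rw [contDiff_euclidean]
  intro i
  fin_cases i <;> simpa

theorem dot3_self_pos {u : E3} (hu : u ≠ 0) : 0 < dot3 u u := by
  by_contra h
  refine hu ?_
  unfold dot3 at h
  ext i
  fin_cases i <;> simp <;> nlinarith [mul_self_nonneg (u 0), mul_self_nonneg (u 1),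
    mul_self_nonneg (u 2)]

theorem dot3_cross3_self (u v : E3) :
    dot3 (cross3 u v) (cross3 u v) = dot3 u u * dot3 v v - dot3 u v ^ 2 := by
  simp [dot3, cross3]
  ring

theorem cross3_ne_zero_of_dot3_eq_zero {u v : E3} (hu : u ≠ 0) (hv : v ≠ 0)
    (huv : dot3 u v = 0) : cross3 u v ≠ 0 := by
  intro h
  have h1 := dot3_cross3_self u v
  have h2 := mul_pos (dot3_self_pos hu) (dot3_self_pos hv)
  have h3 : dot3 (0 : E3) 0 = 0 := by simp [dot3]
  rw [h, huv, h3] at h1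
  linarith

theorem ContDiff.dot3 {n : WithTop ℕ∞} {f g : ℝ → E3} (hf : ContDiff ℝ n f)
    (hg : ContDiff ℝ n g) : ContDiff ℝ n (fun t => dot3 (f t) (g t)) := by
  rw [contDiff_euclidean] at hf hg
  unfold _root_.dot3
  have hf0 := hf 0
  have hf1 := hf 1
  have hf2 := hf 2
  have hg0 := hg 0
  have hg1 := hg 1
  have hg2 := hg 2
  fun_prop

theorem HasDerivAt.dot3 {f g : ℝ → E3} {f' g' : E3} {t : ℝ} (hf : HasDerivAt f f' t)
    (hg : HasDerivAt g g' t) :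
    HasDerivAt (fun s => dot3 (f s) (g s)) (dot3 f' (g t) + dot3 (f t) g') t := by
  have hc : ∀ {h : ℝ → E3} {h' : E3}, HasDerivAt h h' t →
      ∀ i, HasDerivAt (fun s => h s i) (h' i) t :=
    fun hh i => (PiLp.proj 2 (𝕜 := ℝ) (fun _ : Fin 3 => ℝ) i).hasFDerivAt.comp_hasDerivAt t hh
  unfold _root_.dot3
  refine ((((hc hf 0).mul (hc hg 0)).add ((hc hf 1).mul (hc hg 1))).add
    ((hc hf 2).mul (hc hg 2))).congr_deriv ?_
  ring

/-! ### The core curve and its rectifying direction -/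

/-- A closed curve with a single inflection point (at `0`). -/
noncomputable def coreCurve (t : ℝ) : E3 := !₂[sin t, sin t * cos t, (1 - cos t) ^ 3 / 3]

/-- The velocity of `coreCurve`. -/
noncomputable def coreVel (t : ℝ) : E3 :=
  !₂[cos t, 2 * cos t ^ 2 - 1, (1 - cos t) ^ 2 * sin t]

/-- The acceleration of `coreCurve`. -/
noncomputable def coreAcc (t : ℝ) : E3 :=
  !₂[-sin t, -4 * sin t * cos t, (1 - cos t) ^ 2 * (2 + 3 * cos t)]

/-- The binormal direction of `coreCurve`, namely `coreVel × coreAcc` divided by `2 sin (t/2)`. -/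
noncomputable def coreBinormal (t : ℝ) : E3 :=
  !₂[2 * sin (t / 2) ^ 3 * (2 * cos t ^ 3 + 4 * cos t ^ 2 + cos t - 2),
    -2 * sin (t / 2) ^ 3 * (2 * cos t ^ 2 + 2 * cos t + 1),
    -cos (t / 2) * (2 * cos t ^ 2 + 1)]

/-- The derivative of `coreBinormal`. -/
noncomputable def coreBinormalDeriv (t : ℝ) : E3 :=
  !₂[3 * sin (t / 2) ^ 2 * cos (t / 2) * (2 * cos t ^ 3 + 4 * cos t ^ 2 + cos t - 2)
      - 2 * sin (t / 2) ^ 3 * (6 * cos t ^ 2 + 8 * cos t + 1) * sin t,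
    -3 * sin (t / 2) ^ 2 * cos (t / 2) * (2 * cos t ^ 2 + 2 * cos t + 1)
      + 2 * sin (t / 2) ^ 3 * (4 * cos t + 2) * sin t,
    sin (t / 2) / 2 * (2 * cos t ^ 2 + 1) + cos (t / 2) * (4 * cos t) * sin t]

/-- The ratio of torsion to curvature of `coreCurve`, suitably normalized. -/
noncomputable def coreSlope (t : ℝ) : ℝ :=
  -(dot3 (coreVel t) (coreVel t) * sin (t / 2) *
    (4 * cos t ^ 4 + 8 * cos t ^ 3 + 12 * cos t ^ 2 + 16 * cos t + 5)) /
    (2 * dot3 (coreBinormal t) (coreBinormal t))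

/-- The rectifying (Darboux) direction of `coreCurve`. -/
noncomputable def coreDirector (t : ℝ) : E3 := coreBinormal t + coreSlope t • coreVel t

theorem hasDerivAt_coreCurve (t : ℝ) : HasDerivAt coreCurve (coreVel t) t := by
  unfold coreCurve coreVel
  refine hasDerivAt_vec3 (hasDerivAt_sin t) ?_ ?_
  · refine ((hasDerivAt_sin t).mul (hasDerivAt_cos t)).congr_deriv ?_
    linear_combination -sin_sq_add_cos_sq t
  · refine ((((hasDerivAt_cos t).const_sub 1).pow 3).div_const 3).congr_deriv ?_
    push_cast
    ring

theorem hasDerivAt_coreVel (t : ℝ) : HasDerivAt coreVel (coreAcc t) t := by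
  unfold coreVel coreAcc
  refine hasDerivAt_vec3 (hasDerivAt_cos t) ?_ ?_
  · refine ((((hasDerivAt_cos t).pow 2).const_mul 2).sub_const 1).congr_deriv ?_
    push_cast
    ring
  · refine ((((hasDerivAt_cos t).const_sub 1).pow 2).mul (hasDerivAt_sin t)).congr_deriv ?_
    simp
    linear_combination 2 * (1 - cos t) * sin_sq_add_cos_sq t

theorem hasDerivAt_coreBinormal (t : ℝ) :
    HasDerivAt coreBinormal (coreBinormalDeriv t) t := by
  have hS : HasDerivAt (fun s : ℝ => sin (s / 2)) (cos (t / 2) / 2) t :=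
    ((hasDerivAt_id t).div_const 2).sin.congr_deriv (by simp; ring)
  have hC : HasDerivAt (fun s : ℝ => cos (s / 2)) (-sin (t / 2) / 2) t :=
    ((hasDerivAt_id t).div_const 2).cos.congr_deriv (by simp; ring)
  have hk := hasDerivAt_cos t
  unfold coreBinormal coreBinormalDeriv
  refine hasDerivAt_vec3 ?_ ?_ ?_
  · refine (((hS.pow 3).const_mul 2).mul (((((hk.pow 3).const_mul 2).add
      ((hk.pow 2).const_mul 4)).add hk).sub_const 2)).congr_deriv ?_
    push_cast
    simp
    ring
  · refine (((hS.pow 3).const_mul (-2)).mul ((((hk.pow 2).const_mul 2).add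
      (hk.const_mul 2)).add_const 1)).congr_deriv ?_
    push_cast
    simp
    ring
  · refine (hC.neg.mul (((hk.pow 2).const_mul 2).add_const 1)).congr_deriv ?_
    push_cast
    simp
    ring

theorem cos_eq_half (t : ℝ) : cos t = 1 - 2 * sin (t / 2) ^ 2 := by
  have h := cos_two_mul (t / 2)
  rw [mul_div_cancel₀ t two_ne_zero] at h
  linear_combination h + 2 * sin_sq_add_cos_sq (t / 2)

theorem sin_eq_half (t : ℝ) : sin t = 2 * sin (t / 2) * cos (t / 2) := by
  have h := sin_two_mul (t / 2)
  rwa [mul_div_cancel₀ t two_ne_zero] at h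

theorem contDiff_coreVel : ContDiff ℝ ω coreVel := by
  unfold coreVel
  exact contDiff_vec3 (by fun_prop) (by fun_prop) (by fun_prop)

theorem contDiff_coreBinormal : ContDiff ℝ ω coreBinormal := by
  unfold coreBinormal
  exact contDiff_vec3 (by fun_prop) (by fun_prop) (by fun_prop)

theorem coreVel_ne_zero (t : ℝ) : coreVel t ≠ 0 := by
  intro h
  have h0 : cos t = 0 := by simpa [coreVel] using congrArg (fun v : E3 => v 0) h
  have h1 : 2 * cos t ^ 2 - 1 = 0 := by simpa [coreVel] using congrArg (fun v : E3 => v 1) h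
  rw [h0] at h1
  norm_num at h1

theorem coreBinormal_ne_zero (t : ℝ) : coreBinormal t ≠ 0 := by
  intro h
  have h1 : -2 * sin (t / 2) ^ 3 * (2 * cos t ^ 2 + 2 * cos t + 1) = 0 :=
    congrArg (fun v : E3 => v 1) h
  have h2 : -cos (t / 2) * (2 * cos t ^ 2 + 1) = 0 :=
    congrArg (fun v : E3 => v 2) h
  have hS : sin (t / 2) = 0 := by
    rcases mul_eq_zero.1 h1 with h | h
    · simpa using h
    · nlinarith [sq_nonneg (cos t), sq_nonneg (cos t + 1)]
  have hC : cos (t / 2) = 0 := by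
    rcases mul_eq_zero.1 h2 with h | h
    · simpa using h
    · nlinarith [sq_nonneg (cos t)]
  have := sin_sq_add_cos_sq (t / 2)
  simp [hS, hC] at this

theorem contDiff_coreCurve : ContDiff ℝ ω coreCurve := by
  unfold coreCurve
  exact contDiff_vec3 (by fun_prop) (by fun_prop) (by fun_prop)

theorem contDiff_coreSlope : ContDiff ℝ ω coreSlope := by
  unfold coreSlope
  have hV := contDiff_coreVel.dot3 contDiff_coreVel
  have hB := contDiff_coreBinormal.dot3 contDiff_coreBinormal
  refine ContDiff.div (by fun_prop) (by fun_prop) fun t => ?_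
  have := dot3_self_pos (coreBinormal_ne_zero t)
  positivity

theorem contDiff_coreDirector : ContDiff ℝ ω coreDirector :=
  contDiff_coreBinormal.add (contDiff_coreSlope.smul contDiff_coreVel)

theorem cross3_coreVel_coreAcc (t : ℝ) :
    cross3 (coreVel t) (coreAcc t) = (2 * sin (t / 2)) • coreBinormal t := by
  have hC := sin_sq_add_cos_sq (t / 2)
  ext i
  fin_cases i <;> simp [cross3, coreVel, coreAcc, coreBinormal, cos_eq_half t, sin_eq_half t] <;>
    grind

theorem dot3_coreVel_coreBinormal (t : ℝ) : dot3 (coreVel t) (coreBinormal t) = 0 := by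
  have hC := sin_sq_add_cos_sq (t / 2)
  simp [dot3, coreVel, coreBinormal, cos_eq_half t, sin_eq_half t]
  grind

theorem det3_coreVel_coreBinormal (t : ℝ) :
    det3 (coreVel t) (coreBinormal t) (coreBinormalDeriv t) =
      -(dot3 (coreVel t) (coreVel t) * sin (t / 2) ^ 2 *
        (4 * cos t ^ 4 + 8 * cos t ^ 3 + 12 * cos t ^ 2 + 16 * cos t + 5)) := by
  have hC := sin_sq_add_cos_sq (t / 2)
  simp [det3, dot3, cross3, coreVel, coreBinormal, coreBinormalDeriv, cos_eq_half t, sin_eq_half t]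
  grind

theorem dot3_mul_sub_eq_neg_det3 (u a x : E3) :
    dot3 u u * dot3 x a - dot3 u a * dot3 x u = -det3 u (cross3 u a) x := by
  simp [det3, dot3, cross3]
  ring

theorem exists_hasDerivAt_coreDirector (t : ℝ) :
    ∃ r : ℝ, HasDerivAt coreDirector
      (coreBinormalDeriv t + (coreSlope t • coreAcc t + r • coreVel t)) t :=
  ⟨deriv coreSlope t, (hasDerivAt_coreBinormal t).add
    (((contDiff_coreSlope.differentiable (by simp)) t).hasDerivAt.smul (hasDerivAt_coreVel t))⟩

theorem coreSlope_mul (t : ℝ) :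
    coreSlope t * (2 * sin (t / 2) * dot3 (coreBinormal t) (coreBinormal t)) =
      det3 (coreVel t) (coreBinormal t) (coreBinormalDeriv t) := by
  have h := (dot3_self_pos (coreBinormal_ne_zero t)).ne'
  rw [det3_coreVel_coreBinormal, coreSlope]
  field_simp

theorem det3_coreVel_coreBinormal_coreDirector (t : ℝ) :
    det3 (coreVel t) (coreBinormal t) (deriv coreDirector t) = 0 := by
  obtain ⟨r, hr⟩ := exists_hasDerivAt_coreDirector t
  have h1 : det3 (coreVel t) (coreBinormal t) (deriv coreDirector t) =
      det3 (coreVel t) (coreBinormal t) (coreBinormalDeriv t) -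
        coreSlope t * dot3 (coreBinormal t) (cross3 (coreVel t) (coreAcc t)) := by
    rw [hr.deriv]
    simp [det3, dot3, cross3]
    ring
  rw [h1, ← coreSlope_mul, cross3_coreVel_coreAcc]
  simp [dot3]
  ring

theorem det3_coreVel_coreDirector (t : ℝ) :
    det3 (coreVel t) (coreDirector t) (deriv coreDirector t) = 0 := by
  rw [← det3_coreVel_coreBinormal_coreDirector t, coreDirector]
  simp [det3, dot3, cross3]
  ring

theorem dot3_deriv_coreDirector (t : ℝ) :
    dot3 (coreVel t) (coreVel t) * dot3 (deriv coreDirector t) (coreAcc t) =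
      dot3 (coreVel t) (coreAcc t) * dot3 (deriv coreDirector t) (coreVel t) := by
  rw [← sub_eq_zero, dot3_mul_sub_eq_neg_det3, cross3_coreVel_coreAcc, neg_eq_zero,
    ← mul_zero (2 * sin (t / 2)), ← det3_coreVel_coreBinormal_coreDirector t]
  simp [det3, dot3, cross3]
  ring

theorem cross3_coreVel_coreDirector_ne_zero (t : ℝ) :
    cross3 (coreVel t) (coreDirector t) ≠ 0 := by
  have h : cross3 (coreVel t) (coreDirector t) = cross3 (coreVel t) (coreBinormal t) := by
    ext i
    fin_cases i <;> simp [cross3, coreDirector] <;> ring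
  rw [h]
  exact cross3_ne_zero_of_dot3_eq_zero (coreVel_ne_zero t) (coreBinormal_ne_zero t)
    (dot3_coreVel_coreBinormal t)

theorem coreCurve_periodic : Function.Periodic coreCurve (2 * π) := fun t => by
  simp [coreCurve]

theorem coreVel_periodic : Function.Periodic coreVel (2 * π) := fun t => by
  simp [coreVel]

theorem coreBinormal_antiperiodic : Function.Antiperiodic coreBinormal (2 * π) := fun t => by
  have h : (t + 2 * π) / 2 = t / 2 + π := by ring
  ext i
  fin_cases i <;> simp [coreBinormal, h] <;> ring

theorem coreSlope_antiperiodic : Function.Antiperiodic coreSlope (2 * π) := fun t => by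
  have h : (t + 2 * π) / 2 = t / 2 + π := by ring
  have h1 : dot3 (-coreBinormal t) (-coreBinormal t) = dot3 (coreBinormal t) (coreBinormal t) := by
    simp [dot3]
  rw [coreSlope, coreBinormal_antiperiodic, coreVel_periodic, h1, h, coreSlope]
  simp
  ring

theorem coreDirector_antiperiodic : Function.Antiperiodic coreDirector (2 * π) := fun t => by
  simp only [coreDirector, coreBinormal_antiperiodic t, coreSlope_antiperiodic t,
    coreVel_periodic t]
  module

theorem coreCurve_eq_imp {t s : ℝ} (h : coreCurve t = coreCurve s) :
    ∃ k : ℤ, s = t + 2 * π * k := by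
  have h0 : sin t = sin s := by simpa [coreCurve] using congrArg (fun v : E3 => v 0) h
  have h2 : (1 - cos t) ^ 3 = (1 - cos s) ^ 3 := by
    simpa [coreCurve] using congrArg (fun v : E3 => v 2) h
  have h3 : cos t = cos s := by
    have := (show Odd 3 by decide).strictMono_pow.injective h2
    linarith
  obtain ⟨k, hk⟩ := Real.Angle.angle_eq_iff_two_pi_dvd_sub.1
    (Real.Angle.cos_sin_inj h3.symm h0.symm)
  exact ⟨k, by linarith⟩

/-! ### Thin strips are embedded -/

theorem cross3_smul_left (a : ℝ) (u v : E3) : cross3 (a • u) v = a • cross3 u v := by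
  ext i
  fin_cases i <;> simp [cross3] <;> ring

theorem cross3_smul_self (a : ℝ) (v : E3) : cross3 (a • v) v = 0 := by
  ext i
  fin_cases i <;> simp [cross3] <;> ring

theorem continuous_cross3 : Continuous fun p : E3 × E3 => cross3 p.1 p.2 := by
  unfold cross3
  refine (PiLp.continuous_toLp 2 _).comp (continuous_pi fun i => ?_)
  fin_cases i <;> simp <;> fun_prop

theorem Function.Antiperiodic.add_int_mul_eq_smul {ξ : ℝ → E3} {c : ℝ}
    (h : Function.Antiperiodic ξ c) (t : ℝ) (k : ℤ) : ξ (t + c * k) = ((-1 : ℝ) ^ k) • ξ t := by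
  have := h.add_zsmul_eq (x := t) k
  rw [zsmul_eq_mul, mul_comm] at this
  rw [this]
  rcases Int.even_or_odd k with hk | hk
  · simp [hk.neg_one_zpow, Int.negOnePow_even k hk]
  · simp [hk.neg_one_zpow, Int.negOnePow_odd k hk]

open Filter Topology in
/-- Difference quotients with both end points moving converge to the strict derivative. -/
theorem HasStrictDerivAt.tendsto_slope_of_tendsto {f : ℝ → E3} {f' : E3} {x : ℝ}
    (hf : HasStrictDerivAt f f' x) {t s : ℕ → ℝ} (ht : Tendsto t atTop (𝓝 x))
    (hs : Tendsto s atTop (𝓝 x)) (hts : ∀ n, t n ≠ s n) :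
    Tendsto (fun n => (t n - s n)⁻¹ • (f (t n) - f (s n))) atTop (𝓝 f') := by
  have h := ((hasStrictFDerivAt_iff_isLittleO.1 hf.hasStrictFDerivAt).comp_tendsto
    (ht.prodMk_nhds hs)).tendsto_inv_smul_nhds_zero.add_const f'
  rw [zero_add] at h
  refine h.congr fun n => ?_
  simp only [Function.comp_apply, ContinuousLinearMap.toSpanSingleton_apply, smul_sub, smul_smul,
    inv_mul_cancel₀ (sub_ne_zero.2 (hts n)), one_smul, sub_add_cancel]

open Filter Topology in
theorem exists_strip_embedded {c ξ : ℝ → E3} (hc : ContDiff ℝ 1 c) (hξ : ContDiff ℝ 1 ξ)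
    (hcp : Function.Periodic c (2 * π)) (hξp : Function.Antiperiodic ξ (2 * π))
    (hinj : ∀ {t s : ℝ}, c t = c s → ∃ k : ℤ, s = t + 2 * π * k)
    (hcross : ∀ t, cross3 (deriv c t) (ξ t) ≠ 0) :
    ∃ ε : ℝ, 0 < ε ∧ ∀ t s u v : ℝ, u ∈ Set.Ioo (-ε) ε → v ∈ Set.Ioo (-ε) ε →
      c t + u • ξ t = c s + v • ξ s → ∃ k : ℤ, s = t + 2 * π * k ∧ v = (-1 : ℝ) ^ k * u := by
  have hpi := Real.two_pi_pos
  have hcp' : ∀ (t : ℝ) (k : ℤ), c (t + 2 * π * k) = c t := fun t k => by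
    rw [mul_comm]; exact hcp.int_mul k t
  have hsq : ∀ k : ℤ, (-1 : ℝ) ^ k * (-1 : ℝ) ^ k = 1 := fun k => by
    rw [← mul_zpow]; simp
  have habs : ∀ (k : ℤ) (u : ℝ), |(-1 : ℝ) ^ k * u| = |u| := fun k u => by
    rw [abs_mul, abs_zpow]; simp
  by_contra! hcon
  -- normalize the double points
  have key : ∀ n : ℕ, ∃ t s u v : ℝ, t ∈ Set.Icc 0 (2 * π) ∧ |s - t| ≤ π ∧
      |u| < 1 / ((n : ℝ) + 1) ∧ |v| < 1 / ((n : ℝ) + 1) ∧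
      c t + u • ξ t = c s + v • ξ s ∧ ¬ (s = t ∧ v = u) := by
    intro n
    obtain ⟨t, s, u, v, hu, hv, he, hk⟩ := hcon (1 / ((n : ℝ) + 1)) (by positivity)
    set a : ℤ := -⌊t / (2 * π)⌋ with ha
    set b : ℤ := -round ((s - (t + 2 * π * a)) / (2 * π)) with hb
    refine ⟨t + 2 * π * a, s + 2 * π * b, (-1 : ℝ) ^ a * u, (-1 : ℝ) ^ b * v, ⟨?_, ?_⟩, ?_,
      ?_, ?_, ?_, ?_⟩
    · have := Int.floor_le (t / (2 * π))
      rw [le_div_iff₀ hpi] at this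
      rw [ha]; push_cast; linarith
    · have := Int.lt_floor_add_one (t / (2 * π))
      rw [div_lt_iff₀ hpi] at this
      rw [ha]; push_cast; linarith
    · have := abs_sub_round ((s - (t + 2 * π * a)) / (2 * π))
      have h2 : s + 2 * π * b - (t + 2 * π * a) = 2 * π *
          ((s - (t + 2 * π * a)) / (2 * π) - round ((s - (t + 2 * π * a)) / (2 * π))) := by
        rw [hb]; push_cast; field_simp; ring
      rw [h2, abs_mul, abs_of_pos hpi]
      nlinarith
    · rw [habs, abs_lt]; exact hu
    · rw [habs, abs_lt]; exact hv
    · rw [hcp', hcp', hξp.add_int_mul_eq_smul, hξp.add_int_mul_eq_smul, smul_smul, smul_smul,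
        mul_right_comm, hsq, mul_right_comm, hsq, one_mul, one_mul, he]
    · rintro ⟨h1, h2⟩
      refine hk (a - b) (by push_cast; linarith) ?_
      rw [zpow_sub₀ (by norm_num), div_mul_eq_mul_div, eq_div_iff (zpow_ne_zero _ (by norm_num)),
        mul_comm, h2]
  choose t s u v ht hst hu hv he hne using key
  have hlim : Tendsto (fun n : ℕ => 1 / ((n : ℝ) + 1)) atTop (𝓝 0) :=
    tendsto_one_div_add_atTop_nhds_zero_nat
  have hu0 : Tendsto u atTop (𝓝 0) := squeeze_zero_norm (fun n => (hu n).le) hlim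
  have hv0 : Tendsto v atTop (𝓝 0) := squeeze_zero_norm (fun n => (hv n).le) hlim
  have hmem : ∀ n, (t n, s n) ∈ Set.Icc (0 : ℝ) (2 * π) ×ˢ Set.Icc (-π) (3 * π) := fun n => by
    have h1 := ht n
    have h2 := abs_le.1 (hst n)
    exact ⟨h1, by constructor <;> linarith [h1.1, h1.2, h2.1, h2.2]⟩
  obtain ⟨⟨x, y⟩, -, φ, hφ, hxy⟩ := (isCompact_Icc.prod isCompact_Icc).tendsto_subseq hmem
  have htx : Tendsto (t ∘ φ) atTop (𝓝 x) := (continuous_fst.tendsto _).comp hxy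
  have hsy : Tendsto (s ∘ φ) atTop (𝓝 y) := (continuous_snd.tendsto _).comp hxy
  have huφ := hu0.comp hφ.tendsto_atTop
  have hvφ := hv0.comp hφ.tendsto_atTop
  have hcxy : c x = c y := by
    have h1 := ((hc.continuous.tendsto x).comp htx).add
      (huφ.smul ((hξ.continuous.tendsto x).comp htx))
    have h2 := ((hc.continuous.tendsto y).comp hsy).add
      (hvφ.smul ((hξ.continuous.tendsto y).comp hsy))
    simp only [zero_smul, add_zero] at h1 h2
    exact tendsto_nhds_unique h1 (h2.congr fun n => (he (φ n)).symm)
  have hyx : y = x := by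
    obtain ⟨k, hk⟩ := hinj hcxy
    have h1 : |y - x| ≤ π :=
      le_of_tendsto (hsy.sub htx).abs (Eventually.of_forall fun n => hst (φ n))
    have hk0 : k = 0 := by
      rw [hk, add_sub_cancel_left, abs_mul, abs_of_pos hpi] at h1
      have h2 : |(k : ℝ)| < 1 := by nlinarith [Real.pi_pos]
      exact Int.abs_lt_one_iff.1 (by exact_mod_cast h2)
    simpa [hk0] using hk
  subst hyx
  have hξne : ∀ r, ξ r ≠ 0 := fun r h => hcross r (by rw [h]; ext i; fin_cases i <;> simp [cross3])
  have hts : ∀ n, t n ≠ s n := fun n h => hne n ⟨h.symm, by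
    have h1 := he n
    rw [h] at h1
    exact (smul_left_injective ℝ (hξne _) (add_left_cancel h1)).symm⟩
  have hD := ((hc.contDiffAt (x := y)).hasStrictDerivAt one_ne_zero).tendsto_slope_of_tendsto htx
    hsy fun n => hts (φ n)
  have hDξ := ((hξ.contDiffAt (x := y)).hasStrictDerivAt one_ne_zero).tendsto_slope_of_tendsto htx
    hsy fun n => hts (φ n)
  have hlimit := (continuous_cross3.tendsto _).comp
    ((hD.add (huφ.smul hDξ)).prodMk_nhds ((hξ.continuous.tendsto y).comp hsy))
  refine hcross y (tendsto_nhds_unique (l := (atTop : Filter ℕ)) ?_ tendsto_const_nhds)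
  simp only [zero_smul, add_zero] at hlimit
  refine hlimit.congr fun n => ?_
  have h1 : (c (t (φ n)) - c (s (φ n))) + u (φ n) • (ξ (t (φ n)) - ξ (s (φ n))) =
      (v (φ n) - u (φ n)) • ξ (s (φ n)) := by
    have := he (φ n)
    rw [← sub_eq_zero] at this ⊢
    rw [← this]
    module
  simp only [Function.comp_apply]
  rw [smul_comm, ← smul_add, h1, smul_smul, cross3_smul_self]

/-! ### Reparametrization proportional to arc length -/

open Filter Topology in
/-- A real-analytic function extends to a complex-analytic one. -/
theorem AnalyticAt.exists_complex_extension {f : ℝ → ℝ} {x : ℝ} (hf : AnalyticAt ℝ f x) :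
    ∃ g : ℂ → ℂ, AnalyticAt ℂ g x ∧ ∀ᶠ y : ℝ in 𝓝 x, g y = f y := by
  obtain ⟨p, r, hp⟩ := hf
  let q : FormalMultilinearSeries ℂ ℂ ℂ :=
    FormalMultilinearSeries.ofScalars ℂ (fun n => ((p.coeff n : ℝ) : ℂ))
  have hnorm : ∀ n, ‖q n‖ = ‖p n‖ := fun n => by
    rw [FormalMultilinearSeries.ofScalars_norm, Complex.norm_real,
      FormalMultilinearSeries.norm_apply_eq_norm_coef]
  have hrad : r ≤ q.radius := by
    refine hp.r_le.trans (le_of_eq ?_)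
    simp only [FormalMultilinearSeries.radius, hnorm]
  have hq := (q.hasFPowerSeriesOnBall (hp.r_pos.trans_le hrad)).mono hp.r_pos hrad
  refine ⟨fun z => q.sum (z - x), ?_, ?_⟩
  · have h := hq.comp_sub (x : ℂ)
    rw [zero_add] at h
    exact h.analyticAt
  · filter_upwards [Metric.eball_mem_nhds x hp.r_pos] with y hy
    have hy0 : y - x ∈ Metric.eball (0 : ℝ) r := by
      simpa [edist_eq_enorm_sub] using hy
    have h1 := hp.hasSum hy0
    have hy1 : ((y : ℂ) - x) ∈ Metric.eball (0 : ℂ) r := by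
      rw [Metric.mem_eball, edist_zero_right] at hy0 ⊢
      rwa [← Complex.ofReal_sub, ← ofReal_norm, Complex.norm_real, ofReal_norm]
    have h2 := hq.hasSum hy1
    rw [zero_add] at h2
    rw [add_sub_cancel] at h1
    refine h2.unique ?_
    have hterm : (fun n => q n fun _ => (y : ℂ) - x) = fun n => ((p n fun _ => y - x : ℝ) : ℂ) := by
      funext n
      simp [q, FormalMultilinearSeries.ofScalars, mul_comm]
    rw [hterm]
    exact Complex.hasSum_ofReal.2 h1

open Filter Topology in
/-- A primitive of a real-analytic function is real-analytic. -/
theorem AnalyticAt.of_hasDerivAt {f F : ℝ → ℝ} {x : ℝ} (hf : AnalyticAt ℝ f x)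
    (hF : ∀ y, HasDerivAt F (f y) y) : AnalyticAt ℝ F x := by
  obtain ⟨g, hg, hgf⟩ := hf.exists_complex_extension
  obtain ⟨r, hr, hgr⟩ := Metric.eventually_nhds_iff_ball.1 hg.eventually_analyticAt
  obtain ⟨r', hr', hgr'⟩ := Metric.eventually_nhds_iff_ball.1 hgf
  obtain ⟨G, hG⟩ := (show DifferentiableOn ℂ g (Metric.ball (x : ℂ) r) from
    fun z hz => (hgr z hz).differentiableAt.differentiableWithinAt).isExactOn_ball
  have hGx : AnalyticAt ℂ G x := by
    refine DifferentiableOn.analyticAt (s := Metric.ball (x : ℂ) r)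
      (fun z hz => (hG z hz).differentiableAt.differentiableWithinAt) (Metric.ball_mem_nhds _ hr)
  have hre : AnalyticAt ℝ (fun y : ℝ => (G y).re) x := by
    have h1 := hGx.restrictScalars (𝕜 := ℝ)
    exact (Complex.reCLM.analyticAt _).comp (h1.comp (Complex.ofRealCLM.analyticAt x))
  have hd : ∀ y ∈ Metric.ball x (min r r'),
      HasDerivAt (fun y : ℝ => F y - (G y).re) 0 y := fun y hy => by
    have hyr : (y : ℂ) ∈ Metric.ball (x : ℂ) r := by
      have h : dist y x < r := lt_of_lt_of_le hy (min_le_left _ _)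
      rw [Metric.mem_ball, Complex.dist_eq, ← Complex.ofReal_sub, Complex.norm_real]
      exact h
    have h1 := (hG y hyr).real_of_complex
    rw [hgr' y (Metric.ball_subset_ball (min_le_right _ _) hy), Complex.ofReal_re] at h1
    exact ((hF y).sub h1).congr_deriv (sub_self _)
  have hconst : ∀ y ∈ Metric.ball x (min r r'), F y - (G y).re = F x - (G x).re := fun y hy =>
    (convex_ball x (min r r')).is_const_of_fderivWithin_eq_zero (𝕜 := ℝ)
      (fun z hz => (hd z hz).differentiableAt.differentiableWithinAt)
      (fun z hz => by
        rw [fderivWithin_of_isOpen Metric.isOpen_ball hz, (hd z hz).hasFDerivAt.fderiv]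
        ext; simp) hy (Metric.mem_ball_self (lt_min hr hr'))
  refine (hre.add (analyticAt_const (v := F x - (G x).re))).congr ?_
  filter_upwards [Metric.ball_mem_nhds x (lt_min hr hr')] with y hy
  have := hconst y hy
  simp only [Pi.add_apply]
  linarith

open Filter Topology in
/-- Analytic change of parameter turning a periodic speed `v` into a constant one. -/
theorem exists_constant_speed_parameter {v : ℝ → ℝ} (hv : ContDiff ℝ ω v) (hpos : ∀ t, 0 < v t)
    (hper : Function.Periodic v (2 * π)) :
    ∃ (φ : ℝ → ℝ) (K : ℝ), 0 < K ∧ ContDiff ℝ ω φ ∧ (∀ t, HasDerivAt φ (K / v (φ t)) t) ∧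
      (∀ t, φ (t + 2 * π) = φ t + 2 * π) ∧ Function.Injective φ := by
  have hpi := Real.two_pi_pos
  have hint : ∀ a b, IntervalIntegrable v MeasureTheory.volume a b :=
    fun a b => hv.continuous.intervalIntegrable a b
  set L := ∫ r in (0 : ℝ)..(2 * π), v r with hL
  have hLpos : 0 < L :=
    intervalIntegral.intervalIntegral_pos_of_pos (hint _ _) hpos hpi
  set K := L / (2 * π) with hK
  have hKpos : 0 < K := by positivity
  let σ : ℝ → ℝ := fun t => (∫ r in (0 : ℝ)..t, v r) / K
  have hσd : ∀ t, HasDerivAt σ (v t / K) t := fun t =>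
    (intervalIntegral.integral_hasDerivAt_right (hint _ _)
      hv.continuous.stronglyMeasurable.stronglyMeasurableAtFilter
      hv.continuous.continuousAt).div_const K
  have hσa : ContDiff ℝ ω σ := by
    rw [contDiff_iff_contDiffAt]
    intro t
    refine (AnalyticAt.of_hasDerivAt (f := fun t => v t / K) ?_ hσd).contDiffAt
    exact (hv.div_const K).contDiffAt.analyticAt
  have hσp : ∀ t, σ (t + 2 * π) = σ t + 2 * π := fun t => by
    have h1 := hper.intervalIntegral_add_eq t 0
    rw [zero_add] at h1
    have h2 := intervalIntegral.integral_add_adjacent_intervals (hint 0 t) (hint t (t + 2 * π))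
    simp only [σ]
    rw [← h2, h1, add_div, ← hL, hK]
    field_simp
  have hmono : StrictMono σ := strictMono_of_deriv_pos fun t => by
    rw [(hσd t).deriv]; exact div_pos (hpos t) hKpos
  have hσz : ∀ k : ℤ, σ (2 * π * k) = 2 * π * k := by
    have h0 : σ 0 = 0 := by simp [σ]
    intro k
    have h : Function.Periodic (fun t => σ t - t) (2 * π) := fun t => by
      simp only [hσp t]; ring
    have := h.int_mul k 0
    simp only [zero_add, h0, sub_zero] at this
    rw [mul_comm]
    linarith
  have hsurj : Function.Surjective σ := fun y => by
    have h1 := Int.floor_le (y / (2 * π))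
    have h2 := Int.lt_floor_add_one (y / (2 * π))
    rw [le_div_iff₀ hpi] at h1
    rw [div_lt_iff₀ hpi] at h2
    have h3 := hσz (⌊y / (2 * π)⌋ + 1)
    push_cast at h3
    have hmem : y ∈ Set.Icc (σ (2 * π * ⌊y / (2 * π)⌋)) (σ (2 * π * (⌊y / (2 * π)⌋ + 1))) := by
      rw [hσz, h3]
      constructor <;> linarith
    obtain ⟨x, -, hx⟩ := intermediate_value_Icc (by nlinarith) hσa.continuous.continuousOn hmem
    exact ⟨x, hx⟩
  let e : ℝ ≃ₜ ℝ := (hmono.orderIsoOfSurjective σ hsurj).toHomeomorph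
  have he : ∀ t, σ (e.symm t) = t := e.apply_symm_apply
  have hφ : ContDiff ℝ ω e.symm := e.contDiff_symm_deriv (f' := fun t => v t / K)
    (fun t => (div_pos (hpos t) hKpos).ne') hσd hσa
  refine ⟨e.symm, K, hKpos, hφ, fun t => ?_, fun t => ?_, e.symm.injective⟩
  · have := (hσd (e.symm t)).of_local_left_inverse hφ.continuous.continuousAt
      (div_pos (hpos _) hKpos).ne' (Eventually.of_forall he)
    rwa [inv_div] at this
  · refine hmono.injective ?_
    rw [he, hσp, he]

/-- Theorem B: there exists an embedded real-analytic rectifying Möbius developable. -/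
theorem exists_embedded_real_analytic_rectifying_moebius_developable :
    ∃ (γ ξ : ℝ → E3) (ε : ℝ),
      (∀ t, AnalyticAt ℝ γ t) ∧
      (∀ t, γ (t + 2 * π) = γ t) ∧
      (∀ t, deriv γ t ≠ 0) ∧
      (∀ t, AnalyticAt ℝ ξ t) ∧
      (∀ t, ξ (t + 2 * π) = -ξ t) ∧
      (∀ t, cross3 (deriv γ t) (ξ t) ≠ 0) ∧
      (∀ t, det3 (deriv γ t) (ξ t) (deriv ξ t) = 0) ∧
      (∀ t, dot3 (deriv ξ t) (deriv (deriv γ) t) = 0) ∧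
      0 < ε ∧
      (∀ t s u v : ℝ, u ∈ Set.Ioo (-ε) ε → v ∈ Set.Ioo (-ε) ε →
        γ t + u • ξ t = γ s + v • ξ s →
        ∃ k : ℤ, s = t + 2 * π * k ∧ v = (-1 : ℝ) ^ k * u) := by
  have hVpos : ∀ θ, 0 < dot3 (coreVel θ) (coreVel θ) := fun θ => dot3_self_pos (coreVel_ne_zero θ)
  set v : ℝ → ℝ := fun θ => √(dot3 (coreVel θ) (coreVel θ)) with hv
  have hvpos : ∀ θ, 0 < v θ := fun θ => Real.sqrt_pos.2 (hVpos θ)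
  have hvsmooth : ContDiff ℝ ω v :=
    (contDiff_coreVel.dot3 contDiff_coreVel).sqrt fun θ => (hVpos θ).ne'
  obtain ⟨φ, K, hK, hφ, hφd, hφp, hφi⟩ := exists_constant_speed_parameter hvsmooth hvpos
    fun θ => by simp only [hv, coreVel_periodic θ]
  obtain ⟨ε, hε, hemb⟩ := exists_strip_embedded (contDiff_coreCurve.of_le (by simp))
    (contDiff_coreDirector.of_le (by simp)) coreCurve_periodic coreDirector_antiperiodic
    coreCurve_eq_imp fun t => by
      rw [(hasDerivAt_coreCurve t).deriv]
      exact cross3_coreVel_coreDirector_ne_zero t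
  have hφpos : ∀ t, 0 < K / v (φ t) := fun t => div_pos hK (hvpos _)
  have hγd : deriv (coreCurve ∘ φ) = fun t => (K / v (φ t)) • coreVel (φ t) := funext fun t =>
    ((hasDerivAt_coreCurve (φ t)).scomp t (hφd t)).deriv
  have hξd : ∀ t, deriv (coreDirector ∘ φ) t = (K / v (φ t)) • deriv coreDirector (φ t) :=
    fun t => ((contDiff_coreDirector.differentiable (by simp) (φ t)).hasDerivAt.scomp t
      (hφd t)).deriv
  refine ⟨coreCurve ∘ φ, coreDirector ∘ φ, ε,
    fun t => (contDiff_coreCurve.comp hφ).contDiffAt.analyticAt,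
    fun t => by simp only [Function.comp_apply, hφp, coreCurve_periodic (φ t)],
    fun t => ?_, fun t => (contDiff_coreDirector.comp hφ).contDiffAt.analyticAt,
    fun t => by simp only [Function.comp_apply, hφp, coreDirector_antiperiodic (φ t)],
    fun t => ?_, fun t => ?_, fun t => ?_, hε, fun t s a b ha hb h => ?_⟩
  · rw [hγd]
    exact smul_ne_zero (hφpos t).ne' (coreVel_ne_zero _)
  · rw [hγd, Function.comp_apply, cross3_smul_left]
    exact smul_ne_zero (hφpos t).ne' (cross3_coreVel_coreDirector_ne_zero _)
  · rw [hγd, hξd, Function.comp_apply]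
    have h : det3 ((K / v (φ t)) • coreVel (φ t)) (coreDirector (φ t))
        ((K / v (φ t)) • deriv coreDirector (φ t)) = (K / v (φ t)) ^ 2 *
          det3 (coreVel (φ t)) (coreDirector (φ t)) (deriv coreDirector (φ t)) := by
      simp [det3, dot3, cross3]
      ring
    rw [h, det3_coreVel_coreDirector, mul_zero]
  · obtain ⟨α, hα⟩ : ∃ α, HasDerivAt (fun θ => K / v θ) α (φ t) :=
      ⟨_, ((contDiff_const.div hvsmooth fun θ => (hvpos θ).ne').differentiable (n := ω)
        (by simp) (φ t)).hasDerivAt⟩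
    have hU := hα.smul (hasDerivAt_coreVel (φ t))
    set β := K / v (φ t) with hβ
    have hconst : ∀ θ, dot3 ((K / v θ) • coreVel θ) ((K / v θ) • coreVel θ) = K ^ 2 := fun θ => by
      have h1 : v θ ^ 2 = dot3 (coreVel θ) (coreVel θ) := Real.sq_sqrt (hVpos θ).le
      have h2 := (hvpos θ).ne'
      have h3 : dot3 ((K / v θ) • coreVel θ) ((K / v θ) • coreVel θ) =
          (K / v θ) ^ 2 * dot3 (coreVel θ) (coreVel θ) := by
        simp [dot3]
        ring
      rw [h3, ← h1]
      field_simp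
    have horth := (hU.dot3 hU).unique
      ((hasDerivAt_const (φ t) (K ^ 2)).congr_of_eventuallyEq (Filter.Eventually.of_forall hconst))
    have hγdd : deriv (deriv (coreCurve ∘ φ)) t =
        β • (β • coreAcc (φ t) + α • coreVel (φ t)) := by
      rw [hγd]
      exact (hU.scomp t (hφd t)).deriv
    have hβpos : 0 < β := hφpos t
    have hrect := dot3_deriv_coreDirector (φ t)
    have hVV := hVpos (φ t)
    rw [hγdd, hξd, ← hβ]
    have horth' : β * dot3 (coreVel (φ t)) (coreAcc (φ t)) +
        α * dot3 (coreVel (φ t)) (coreVel (φ t)) = 0 := by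
      refine (mul_eq_zero.1 ?_).resolve_left (mul_pos two_pos hβpos).ne'
      rw [← horth]
      simp [dot3, ← hβ]
      ring
    refine (mul_eq_zero.1 ?_).resolve_left hVV.ne'
    have hexp : dot3 (β • deriv coreDirector (φ t)) (β • (β • coreAcc (φ t) + α • coreVel (φ t))) =
        β ^ 2 * (β * dot3 (deriv coreDirector (φ t)) (coreAcc (φ t)) +
          α * dot3 (deriv coreDirector (φ t)) (coreVel (φ t))) := by
      simp [dot3]
      ring
    rw [hexp]
    linear_combination β ^ 3 * hrect +
      β ^ 2 * dot3 (deriv coreDirector (φ t)) (coreVel (φ t)) * horth'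
  · obtain ⟨k, hk, hab⟩ := hemb (φ t) (φ s) a b ha hb h
    have hper : Function.Periodic (fun t => φ t - t) (2 * π) := fun t => by
      simp only [hφp t]
      ring
    have hshift := hper.int_mul k t
    refine ⟨k, hφi ?_, hab⟩
    rw [hk, mul_comm (2 * π)]
    linarith
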